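/- (Pascal's theorem for the parabola.) Let x₁,x₂,x₃,y₁,y₂,y₃ be pairwise distinct real numbers and set Xⱼ = P(xⱼ), Yⱼ = P(yⱼ). Suppose A₁ ∈ ℝ² lies on the lines X₁X₂ and Y₁Y₂, A₂ lies on the lines X₂X₃ and Y₂Y₃, and A₃ lies on the lines X₃Y₁ and Y₃X₁. Then A₁, A₂, A₃ are collinear. -/

import Mathlib

/-- The point `(t, t²)` on the parabola `y = x²`. -/
noncomputable def Pb (t : ℝ) : ℝ × ℝ := (t, t ^ 2)

theorem snd_eq_of_mem_line_Pb {s t : ℝ} {A : ℝ × ℝ} (h : A ∈ line[ℝ, Pb s, Pb t]) :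
    A.2 = (s + t) * A.1 - s * t := by
  obtain ⟨r, rfl⟩ := mem_affineSpan_pair_iff_exists_lineMap_eq.1 h
  simp only [Pb, AffineMap.lineMap_apply, vsub_eq_sub, vadd_eq_add, Prod.mk_sub_mk, Prod.smul_mk,
    Prod.mk_add_mk, smul_eq_mul]
  ring

theorem add_ne_add_and_fst_eq_of_mem_chords {a b c d : ℝ} {A : ℝ × ℝ} (hac : a ≠ c) (had : a ≠ d)
    (h : A ∈ line[ℝ, Pb a, Pb b]) (h' : A ∈ line[ℝ, Pb c, Pb d]) :
    a + b - (c + d) ≠ 0 ∧ A.1 = (a * b - c * d) / (a + b - (c + d)) := by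
  have e := snd_eq_of_mem_line_Pb h
  have e' := snd_eq_of_mem_line_Pb h'
  have hne : a + b - (c + d) ≠ 0 := fun h0 ↦
    mul_ne_zero (sub_ne_zero.2 hac) (sub_ne_zero.2 had)
    (by linear_combination e' - e + (a - A.1) * h0)
  refine ⟨hne, ?_⟩
  rw [eq_div_iff hne]
  linear_combination e' - e

theorem collinear_triple_of_det_eq_zero {A B C : ℝ × ℝ}
    (h : (B.1 - A.1) * (C.2 - A.2) = (C.1 - A.1) * (B.2 - A.2)) :
    Collinear ℝ ({A, B, C} : Set (ℝ × ℝ)) := by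
  by_cases hAB : A = B
  · subst hAB
    simpa using collinear_pair ℝ A C
  have hpos : (B.1 - A.1) ^ 2 + (B.2 - A.2) ^ 2 ≠ 0 := by
    intro h0
    apply hAB
    ext <;> nlinarith [sq_nonneg (B.1 - A.1), sq_nonneg (B.2 - A.2)]
  have hC : C ∈ line[ℝ, A, B] := by
    refine mem_affineSpan_pair_iff_exists_lineMap_eq.2
      ⟨((B.1 - A.1) * (C.1 - A.1) + (B.2 - A.2) * (C.2 - A.2)) /
        ((B.1 - A.1) ^ 2 + (B.2 - A.2) ^ 2), ?_⟩
    ext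
    · simp only [AffineMap.lineMap_apply, vsub_eq_sub, vadd_eq_add, Prod.fst_add, Prod.smul_fst,
        Prod.fst_sub, smul_eq_mul]
      field_simp
      linear_combination (B.2 - A.2) * h
    · simp only [AffineMap.lineMap_apply, vsub_eq_sub, vadd_eq_add, Prod.snd_add, Prod.smul_snd,
        Prod.snd_sub, smul_eq_mul]
      field_simp
      linear_combination (A.1 - B.1) * h
  have := collinear_insert_of_mem_affineSpan_pair hC
  rwa [show ({A, B, C} : Set (ℝ × ℝ)) = {C, A, B} by
    ext; simp only [Set.mem_insert_iff, Set.mem_singleton_iff]; tauto]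

/-- Pascal's theorem for a hexagon inscribed in the parabola `y = x²`. -/
theorem stmt_2 (x₁ x₂ x₃ y₁ y₂ y₃ : ℝ)
    (hdist : List.Pairwise (· ≠ ·) [x₁, x₂, x₃, y₁, y₂, y₃])
    (A₁ A₂ A₃ : ℝ × ℝ)
    (hA₁x : A₁ ∈ line[ℝ, Pb x₁, Pb x₂]) (hA₁y : A₁ ∈ line[ℝ, Pb y₁, Pb y₂])
    (hA₂x : A₂ ∈ line[ℝ, Pb x₂, Pb x₃]) (hA₂y : A₂ ∈ line[ℝ, Pb y₂, Pb y₃])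
    (hA₃x : A₃ ∈ line[ℝ, Pb x₃, Pb y₁]) (hA₃y : A₃ ∈ line[ℝ, Pb y₃, Pb x₁]) :
    Collinear ℝ ({A₁, A₂, A₃} : Set (ℝ × ℝ)) := by
  simp only [List.pairwise_cons, List.mem_cons, List.not_mem_nil, or_false, forall_eq_or_imp,
    forall_eq] at hdist
  obtain ⟨⟨-, h13, h1y1, h1y2, h1y3⟩, ⟨-, h2y1, h2y2, h2y3⟩, ⟨h3y1, h3y2, h3y3⟩, -⟩ := hdist
  obtain ⟨hd₁, hu₁⟩ := add_ne_add_and_fst_eq_of_mem_chords h1y1 h1y2 hA₁x hA₁y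
  obtain ⟨hd₂, hu₂⟩ := add_ne_add_and_fst_eq_of_mem_chords h2y2 h2y3 hA₂x hA₂y
  obtain ⟨hd₃, hu₃⟩ := add_ne_add_and_fst_eq_of_mem_chords h3y3 h13.symm hA₃x hA₃y
  apply collinear_triple_of_det_eq_zero
  rw [snd_eq_of_mem_line_Pb hA₁x, snd_eq_of_mem_line_Pb hA₂x, snd_eq_of_mem_line_Pb hA₃x,
    hu₁, hu₂, hu₃]
  field_simp
  ring
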